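/- arXiv:1708.03691 — 7 statements merged into one kernel-verified Lean document; each statement's English description precedes it below -/
import Mathlib

section
/- add(N) = 𝔟_{R₁} and cof(N) = 𝔡_{R₁}, where the null ideal is that of Lebesgue measure on ℝ. -/
open Cardinal MeasureTheory Filter

/-- `F` is `R`-unbounded: no single `g` satisfies `f R g` for all `f ∈ F`. -/
def RUnbounded {X : Type*} (R : X → X → Prop) (F : Set X) : Prop :=
  ¬ ∃ g : X, ∀ f ∈ F, R f g

/-- `D` is `R`-dominating: every `f` satisfies `f R g` for some `g ∈ D`. -/
def RDominating {X : Type*} (R : X → X → Prop) (D : Set X) : Prop :=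
  ∀ f : X, ∃ g ∈ D, R f g

/-- `𝔟_R`: the least cardinality of an `R`-unbounded family. -/
noncomputable def bR {X : Type*} (R : X → X → Prop) : Cardinal :=
  sInf { c | ∃ F : Set X, RUnbounded R F ∧ #F = c }

/-- `𝔡_R`: the least cardinality of an `R`-dominating family. -/
noncomputable def dR {X : Type*} (R : X → X → Prop) : Cardinal :=
  sInf { c | ∃ D : Set X, RDominating R D ∧ #D = c }

/-- The space `C` of sequences of strictly positive rationals with sum at most `1`
(expressed via finite partial sums). -/
def Cspace : Set (ℕ → ℚ) :=
  { q | (∀ n, 0 < q n) ∧ ∀ F : Finset ℕ, ∑ n ∈ F, q n ≤ 1 }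

/-- The relation `R₁` on `C`: eventual pointwise domination. -/
def R1 (f g : Cspace) : Prop :=
  ∀ᶠ n in atTop, (f : ℕ → ℚ) n ≤ (g : ℕ → ℚ) n

/-- `add(N)`: the least cardinality of a family of Lebesgue measure-zero sets
whose union is not measure-zero. -/
noncomputable def addNull : Cardinal :=
  sInf { c | ∃ F : Set (Set ℝ),
    (∀ A ∈ F, volume A = 0) ∧ volume (⋃₀ F) ≠ 0 ∧ #F = c }

/-- `cof(N)`: the least cardinality of a family of measure-zero sets such that every
measure-zero set is contained in some member. -/
noncomputable def cofNull : Cardinal :=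
  sInf { c | ∃ F : Set (Set ℝ),
    (∀ A ∈ F, volume A = 0) ∧ (∀ N : Set ℝ, volume N = 0 → ∃ A ∈ F, N ⊆ A) ∧ #F = c }

open Set Topology ENNReal

section Tukey

variable {X Y : Type} {R : X → X → Prop} {S : Y → Y → Prop} {φ : X → Y} {ψ : Y → X}

lemma RUnbounded.image_of_tukey (h : ∀ x y, S (φ x) y → R x (ψ y)) {F : Set X}
    (hF : RUnbounded R F) : RUnbounded S (φ '' F) := fun ⟨y, hy⟩ =>
  hF ⟨ψ y, fun x hx => h x y (hy _ (mem_image_of_mem φ hx))⟩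

lemma RDominating.image_of_tukey (h : ∀ x y, S (φ x) y → R x (ψ y)) {D : Set Y}
    (hD : RDominating S D) : RDominating R (ψ '' D) := fun x =>
  let ⟨y, hy, hxy⟩ := hD (φ x)
  ⟨ψ y, mem_image_of_mem ψ hy, h x y hxy⟩

lemma bR_le_of_tukey (h : ∀ x y, S (φ x) y → R x (ψ y)) (hR : ∃ F, RUnbounded R F) :
    bR S ≤ bR R := by
  obtain ⟨F₀, hF₀⟩ := hR
  refine le_csInf ⟨_, F₀, hF₀, rfl⟩ ?_
  rintro _ ⟨F, hF, rfl⟩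
  have hmem : #(φ '' F) ∈ { c | ∃ F : Set Y, RUnbounded S F ∧ #F = c } :=
    ⟨_, hF.image_of_tukey h, rfl⟩
  exact (csInf_le' hmem).trans mk_image_le

lemma dR_le_of_tukey (h : ∀ x y, S (φ x) y → R x (ψ y)) (hS : ∀ y, S y y) :
    dR R ≤ dR S := by
  refine le_csInf ⟨_, Set.univ, fun y => ⟨y, mem_univ y, hS y⟩, rfl⟩ ?_
  rintro _ ⟨D, hD, rfl⟩
  have hmem : #(ψ '' D) ∈ { c | ∃ D : Set X, RDominating R D ∧ #D = c } :=
    ⟨_, hD.image_of_tukey h, rfl⟩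
  exact (csInf_le' hmem).trans mk_image_le

/-- Relations that are Tukey equivalent have the same cardinal characteristics. -/
lemma bR_eq_and_dR_eq_of_tukey {φ' : Y → X} {ψ' : X → Y}
    (h : ∀ x y, S (φ x) y → R x (ψ y)) (h' : ∀ y x, R (φ' y) x → S y (ψ' x))
    (hR : ∀ x, R x x) (hS : ∀ y, S y y) (hunb : ∃ F, RUnbounded R F) :
    bR R = bR S ∧ dR R = dR S :=
  ⟨(bR_le_of_tukey h' (hunb.imp' _ fun _ hF => hF.image_of_tukey h)).antisymm
      (bR_le_of_tukey h hunb),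
    (dR_le_of_tukey h hS).antisymm (dR_le_of_tukey h' hR)⟩

end Tukey

/-- The inclusion relation on the Lebesgue null ideal of `ℝ`. -/
def nullSubset (A B : {A : Set ℝ // volume A = 0}) : Prop :=
  A.1 ⊆ B.1

lemma rUnbounded_nullSubset_iff (F : Set {A : Set ℝ // volume A = 0}) :
    RUnbounded nullSubset F ↔ volume (⋃₀ (Subtype.val '' F)) ≠ 0 := by
  refine not_congr ⟨?_, fun h => ⟨⟨_, h⟩, fun A hA => subset_sUnion_of_mem ⟨A, hA, rfl⟩⟩⟩
  rintro ⟨B, hB⟩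
  refine measure_mono_null (sUnion_subset ?_) B.2
  rintro _ ⟨A, hA, rfl⟩
  exact hB A hA

lemma exists_subtype_image_eq {F : Set (Set ℝ)} (hF : ∀ A ∈ F, volume A = 0) :
    ∃ F' : Set {A : Set ℝ // volume A = 0}, Subtype.val '' F' = F :=
  ⟨Subtype.val ⁻¹' F, image_preimage_eq_of_subset fun A hA => ⟨⟨A, hF A hA⟩, rfl⟩⟩

lemma addNull_eq_bR : addNull = bR nullSubset := by
  unfold addNull bR
  congr 1
  ext c
  constructor
  · rintro ⟨F, hF, hU, rfl⟩
    obtain ⟨F, rfl⟩ := exists_subtype_image_eq hF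
    exact ⟨F, (rUnbounded_nullSubset_iff F).2 hU, (mk_image_eq Subtype.val_injective).symm⟩
  · rintro ⟨F, hF, rfl⟩
    refine ⟨Subtype.val '' F, ?_, (rUnbounded_nullSubset_iff F).1 hF,
      mk_image_eq Subtype.val_injective⟩
    rintro _ ⟨A, -, rfl⟩
    exact A.2

lemma cofNull_eq_dR : cofNull = dR nullSubset := by
  unfold cofNull dR
  congr 1
  ext c
  constructor
  · rintro ⟨F, hF, hD, rfl⟩
    obtain ⟨F, rfl⟩ := exists_subtype_image_eq hF
    refine ⟨F, fun N => ?_, (mk_image_eq Subtype.val_injective).symm⟩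
    obtain ⟨_, ⟨A, hA, rfl⟩, hNA⟩ := hD N.1 N.2
    exact ⟨A, hA, hNA⟩
  · rintro ⟨F, hF, rfl⟩
    refine ⟨Subtype.val '' F, ?_, fun N hN => ?_, mk_image_eq Subtype.val_injective⟩
    · rintro _ ⟨A, -, rfl⟩
      exact A.2
    · obtain ⟨A, hA, hNA⟩ := hF ⟨N, hN⟩
      exact ⟨A, ⟨A, hA, rfl⟩, hNA⟩

lemma rUnbounded_nullSubset_univ : RUnbounded nullSubset Set.univ := fun ⟨B, hB⟩ => by
  have hBu : B.1 = Set.univ := eq_univ_of_forall fun x =>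
    hB ⟨{x}, Real.volume_singleton⟩ (mem_univ _) rfl
  simpa [hBu] using B.2

lemma tsum_ofReal_le_one (q : Cspace) : ∑' n, ENNReal.ofReal ((q : ℕ → ℚ) n) ≤ 1 := by
  rw [ENNReal.tsum_eq_iSup_sum]
  refine iSup_le fun s => ?_
  rw [← ENNReal.ofReal_sum_of_nonneg fun n _ => by exact_mod_cast (q.2.1 n).le,
    ENNReal.ofReal_le_one]
  exact_mod_cast q.2.2 s

/-- An extended-nonnegative sequence with sum less than `1` lies below a member of `Cspace`. -/
lemma exists_cspace_ge {u : ℕ → ℝ≥0∞} (hu : ∑' n, u n < 1) :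
    ∃ g : Cspace, ∀ n, u n ≤ ENNReal.ofReal ((g : ℕ → ℚ) n) := by
  obtain ⟨ε, hε, hεsum⟩ := ENNReal.exists_pos_sum_of_countable' (tsub_pos_of_lt hu).ne' ℕ
  have key n : ∃ q : ℚ, 0 ≤ q ∧ u n < Real.toNNReal q ∧ (Real.toNNReal q : ℝ≥0∞) < u n + ε n :=
    ENNReal.lt_iff_exists_rat_btwn.1
      (ENNReal.lt_add_right (ENNReal.ne_top_of_tsum_ne_top (hu.trans one_lt_top).ne n) (hε n).ne')
  choose g hg0 hug hgu using key
  have hgpos n : 0 < g n := by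
    have : (0 : ℝ≥0∞) < Real.toNNReal (g n) := (hug n).bot_lt
    simpa using this
  refine ⟨⟨g, hgpos, fun s => ?_⟩, fun n => (hug n).le⟩
  have : ENNReal.ofReal ((∑ n ∈ s, g n : ℚ) : ℝ) ≤ 1 := calc
    ENNReal.ofReal ((∑ n ∈ s, g n : ℚ) : ℝ) = ∑ n ∈ s, ENNReal.ofReal (g n) := by
      rw [Rat.cast_sum, ENNReal.ofReal_sum_of_nonneg fun n _ => by exact_mod_cast hg0 n]
    _ ≤ ∑ n ∈ s, (u n + ε n) := Finset.sum_le_sum fun n _ => (hgu n).le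
    _ ≤ ∑' n, (u n + ε n) := ENNReal.sum_le_tsum s
    _ = ∑' n, u n + ∑' n, ε n := ENNReal.tsum_add
    _ ≤ ∑' n, u n + (1 - ∑' n, u n) := by gcongr
    _ = 1 := add_tsub_cancel_of_le hu.le
  exact_mod_cast ENNReal.ofReal_le_one.1 this

/-- Countably many summable sequences are simultaneously eventually dominated by a member of
`Cspace`. -/
lemma exists_cspace_eventually_ge {ι : Type*} [Countable ι] (h : ι → ℕ → ℝ≥0∞)
    (hh : ∀ i, ∑' n, h i n ≠ ∞) :
    ∃ g : Cspace, ∀ i, ∀ᶠ n in atTop, h i n ≤ ENNReal.ofReal ((g : ℕ → ℚ) n) := by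
  obtain ⟨ε, hε, hεsum⟩ := ENNReal.exists_pos_sum_of_countable' one_ne_zero ι
  have key i : ∃ N, ∑' k, h i (k + N) < ε i :=
    ((ENNReal.tendsto_sum_nat_add _ (hh i)).eventually_lt_const (hε i)).exists
  choose N hN using key
  have htail i : ∑' n, (if N i ≤ n then h i n else 0) = ∑' k, h i (k + N i) := by
    rw [← Summable.sum_add_tsum_nat_add' (k := N i) ENNReal.summable,
      Finset.sum_eq_zero fun n hn => if_neg (by simpa using hn)]
    simp
  obtain ⟨g, hg⟩ := exists_cspace_ge (u := fun n => ∑' i, if N i ≤ n then h i n else 0) <| by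
    rw [ENNReal.tsum_comm]
    simp_rw [htail]
    exact (ENNReal.tsum_le_tsum fun i => (hN i).le).trans_lt hεsum
  refine ⟨g, fun i => ?_⟩
  filter_upwards [eventually_ge_atTop (N i)] with n hn
  refine le_trans ?_ (hg n)
  simpa [hn] using ENNReal.le_tsum (f := fun i => if N i ≤ n then h i n else 0) i

/-- A null set of reals is covered by rational half-open intervals of small total length. -/
lemma exists_rat_Ioc_cover {A : Set ℝ} (hA : volume A = 0) {ε : ℝ≥0∞} (hε : ε ≠ 0) :
    ∃ p : ℕ → ℚ × ℚ, (A ⊆ ⋃ j, Ioc ((p j).1 : ℝ) (p j).2) ∧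
      ∑' j, volume (Ioc ((p j).1 : ℝ) (p j).2) < ε := by
  have hε2 : ε / 2 ≠ 0 := by simpa using hε
  obtain ⟨δ, hδ, hδsum⟩ := ENNReal.exists_pos_sum_of_countable' hε2 ℕ
  have hA' : StieltjesFunction.id.outer A < ε / 2 := by
    have : StieltjesFunction.id.outer A = 0 := by
      rw [← hA, Real.volume_eq_stieltjes_id, StieltjesFunction.measure_def]; rfl
    rw [this]
    exact hε2.bot_lt
  rw [StieltjesFunction.outer, OuterMeasure.ofFunction_apply] at hA'
  simp only [iInf_lt_iff] at hA'
  obtain ⟨t, hAt, ht⟩ := hA'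
  have key j : ∃ p : ℚ × ℚ, t j ⊆ Ioc (p.1 : ℝ) p.2 ∧
      volume (Ioc (p.1 : ℝ) p.2) < StieltjesFunction.id.length (t j) + δ j := by
    have hlt : StieltjesFunction.id.length (t j) < StieltjesFunction.id.length (t j) + δ j :=
      ENNReal.lt_add_right (ENNReal.ne_top_of_tsum_ne_top ht.ne_top j) (hδ j).ne'
    conv_lhs at hlt => rw [StieltjesFunction.length_eq]
    simp only [iInf_lt_iff] at hlt
    obtain ⟨a, b, hab, hlt⟩ := hlt
    have hbot : (botSet : Set ℝ) = ∅ := eq_empty_of_forall_notMem fun x hx => not_isBot x hx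
    rw [hbot, sdiff_empty] at hab
    have hcont : Tendsto (fun η : ℝ => ENNReal.ofReal (b + η - (a - η))) (𝓝[>] 0)
        (𝓝 (ENNReal.ofReal (b - a))) := by
      refine (ENNReal.continuous_ofReal.tendsto' _ _ ?_).comp
        (tendsto_nhdsWithin_of_tendsto_nhds
          (Continuous.tendsto' (f := fun η : ℝ => b + η - (a - η)) (by fun_prop) 0 (b - a)
            (by simp)))
      simp
    obtain ⟨η, hη, hη0⟩ :=
      ((hcont.eventually_lt_const hlt).and self_mem_nhdsWithin).exists
    have hη0 : 0 < η := hη0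
    obtain ⟨x, hx, hx'⟩ := exists_rat_btwn (sub_lt_self a hη0)
    obtain ⟨y, hy, hy'⟩ := exists_rat_btwn (lt_add_of_pos_right b hη0)
    refine ⟨(x, y), hab.trans (Ioc_subset_Ioc hx'.le hy.le), ?_⟩
    rw [Real.volume_Ioc]
    exact (ENNReal.ofReal_le_ofReal (by linarith)).trans_lt hη
  choose p htp hp using key
  refine ⟨p, hAt.trans (iUnion_mono htp), ?_⟩
  calc ∑' j, volume (Ioc ((p j).1 : ℝ) (p j).2)
      ≤ ∑' j, (StieltjesFunction.id.length (t j) + δ j) :=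
        ENNReal.tsum_le_tsum fun j => (hp j).le
    _ = ∑' j, StieltjesFunction.id.length (t j) + ∑' j, δ j := ENNReal.tsum_add
    _ < ε / 2 + ε / 2 := ENNReal.add_lt_add ht hδsum
    _ = ε := ENNReal.add_halves ε

/-- The half-open rational intervals, enumerated with infinitely many repetitions. -/
def ratIoc (i : ℕ × ℕ × ℚ × ℚ) : Set ℝ :=
  Ioc (i.2.2.1 : ℝ) i.2.2.2

/-- The set coded by `q` through the intervals of length at most `q n`. -/
def nullOfCspace (e : ℕ ≃ ℕ × ℕ × ℚ × ℚ) (q : Cspace) : Set ℝ :=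
  {x | ∃ᶠ n in atTop, x ∈ ratIoc (e n) ∧
    volume (ratIoc (e n)) ≤ ENNReal.ofReal ((q : ℕ → ℚ) n)}

lemma volume_nullOfCspace (e : ℕ ≃ ℕ × ℕ × ℚ × ℚ) (q : Cspace) :
    volume (nullOfCspace e q) = 0 := by
  refine measure_setOfPred_frequently_eq_zero (ne_top_of_le_ne_top one_ne_top
    ((ENNReal.tsum_le_tsum fun n => ?_).trans (tsum_ofReal_le_one q)))
  by_cases h : volume (ratIoc (e n)) ≤ ENNReal.ofReal ((q : ℕ → ℚ) n)
  · simp [h]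
  · simp [h]

lemma exists_cspace_forall_R1_subset (e : ℕ ≃ ℕ × ℕ × ℚ × ℚ) {A : Set ℝ} (hA : volume A = 0) :
    ∃ q : Cspace, ∀ g, R1 q g → A ⊆ nullOfCspace e g := by
  obtain ⟨ε, hε, hεsum⟩ := ENNReal.exists_pos_sum_of_countable' one_ne_zero ℕ
  choose p hAp hp using fun k => exists_rat_Ioc_cover hA (hε k).ne'
  let u : ℕ × ℕ × ℚ × ℚ → ℝ≥0∞ := fun i => if i.2.2 = p i.1 i.2.1 then volume (ratIoc i) else 0
  have hu : ∑' n, u (e n) < 1 := by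
    rw [e.tsum_eq u, ENNReal.tsum_prod']
    refine (ENNReal.tsum_le_tsum fun k => ?_).trans_lt hεsum
    rw [ENNReal.tsum_prod']
    refine le_trans (ENNReal.tsum_le_tsum fun j => ?_) (hp k).le
    simp only [u, ratIoc]
    rw [tsum_eq_single (p k j) fun r hr => if_neg hr, if_pos rfl]
  obtain ⟨q, hq⟩ := exists_cspace_ge hu
  refine ⟨q, fun g hqg x hx => ?_⟩
  choose j hj using fun k => mem_iUnion.1 (hAp k hx)
  have hinj : Function.Injective fun k => e.symm (k, j k, p k (j k)) := fun k l hkl =>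
    congrArg Prod.fst (e.symm.injective hkl)
  refine Frequently.mono (p := fun n => n ∈ range fun k => e.symm (k, j k, p k (j k)))
    ?_ (fun n hn => hn) |>.and_eventually hqg |>.mono ?_
  · exact Nat.frequently_atTop_iff_infinite.2 (infinite_range_of_injective hinj)
  · rintro _ ⟨⟨k, rfl⟩, hk⟩
    have hqk := hq (e.symm (k, j k, p k (j k)))
    simp only [u, Equiv.apply_symm_apply, if_true] at hqk
    simp only [Equiv.apply_symm_apply]
    exact ⟨hj k, hqk.trans (ENNReal.ofReal_le_ofReal (by exact_mod_cast hk))⟩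

/-- There are independent events in `[0, 1]` with arbitrary prescribed probabilities: a subset of
`[0, 1]` avoiding finitely many of them has measure at most the product of the complementary
probabilities. -/
lemma exists_independent_sets {ι : Type} [Countable ι] (r : ι → unitInterval) :
    ∃ G : ι → Set ℝ, (∀ i, MeasurableSet (G i)) ∧
      (∀ i, volume (G i) = ENNReal.ofReal (r i)) ∧
      ∀ (s : Finset ι) (W : Set ℝ), W ⊆ Icc 0 1 → (∀ i ∈ s, W ∩ G i = ∅) →
        volume W ≤ ∏ i ∈ s, ENNReal.ofReal (1 - r i) := by
  obtain ⟨f, hf, hfmap⟩ := Measure.exists_measurable_map_eq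
    (Measure.infinitePi fun _ : ι => (volume : Measure unitInterval))
  have hmeas i (T : Set unitInterval) (hT : MeasurableSet T) :
      MeasurableSet {x | f x i ∈ T} := (measurable_pi_apply i).comp hf hT
  have hpi (s : Finset ι) (T : ι → Set unitInterval) (hT : ∀ i, MeasurableSet (T i)) :
      volume (f ⁻¹' (s : Set ι).pi T) = ∏ i ∈ s, volume (T i) := by
    rw [← Measure.infinitePi_pi (μ := fun _ : ι => (volume : Measure unitInterval))
      fun i _ => hT i, ← hfmap, Measure.map_apply hf]
    exact MeasurableSet.pi s.countable_toSet fun i _ => hT i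
  refine ⟨fun i => Subtype.val '' {x | f x i ∈ Iio (r i)},
    fun i => measurableSet_Icc.subtype_image (hmeas i _ measurableSet_Iio), fun i => ?_,
    fun s W hW hWs => ?_⟩
  · rw [volume_image_subtype_coe measurableSet_Icc]
    have := hpi {i} (fun i => Iio (r i)) fun i => measurableSet_Iio
    simpa [preimage, Set.pi] using this
  · have hsub : W ⊆ Subtype.val '' (f ⁻¹' (s : Set ι).pi fun i => Ici (r i)) := by
      intro x hx
      refine ⟨⟨x, hW hx⟩, fun i hi => mem_Ici.2 (not_lt.1 fun hlt => ?_), rfl⟩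
      exact (hWs i hi).subset ⟨hx, ⟨x, hW hx⟩, hlt, rfl⟩
    refine (measure_mono hsub).trans_eq ?_
    rw [volume_image_subtype_coe measurableSet_Icc, hpi s _ fun i => measurableSet_Ici]
    simp

/-- Given countably many measurable sets of finite measure and a null set, there is a
nonempty closed set avoiding the null set, all of whose nonempty relatively open subsets have
positive measure, and in which each of the given sets is relatively open. -/
lemma exists_isClosed_forall_inter_eq {ι : Type} [Countable ι] {G : ι → Set ℝ}
    (hG : ∀ i, MeasurableSet (G i)) (hGtop : ∀ i, volume (G i) ≠ ∞) {B : Set ℝ}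
    (hB : volume B = 0) :
    ∃ (K : Set ℝ) (U : ι → Set ℝ), IsClosed K ∧ K.Nonempty ∧ K ⊆ Icc 0 1 ∧ Disjoint K B ∧
      (∀ O, IsOpen O → (O ∩ K).Nonempty → volume (O ∩ K) ≠ 0) ∧
      ∀ i, IsOpen (U i) ∧ U i ∩ K = G i ∩ K := by
  obtain ⟨ε, hε, hεsum⟩ := ENNReal.exists_pos_sum_of_countable' one_ne_zero ι
  choose U hGU hU _ hUε using fun i =>
    (hG i).exists_isOpen_sdiff_lt (hGtop i) (hε i).ne'
  set E := toMeasurable volume B ∪ ⋃ i, U i \ G i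
  have hEmeas : MeasurableSet E := (measurableSet_toMeasurable _ _).union
    (.iUnion fun i => (hU i).measurableSet.diff (hG i))
  have hElt : volume E < 1 := calc
    volume E ≤ volume (toMeasurable volume B) + ∑' i, volume (U i \ G i) :=
      (measure_union_le _ _).trans (by gcongr; exact measure_iUnion_le _)
    _ ≤ ∑' i, ε i := by
      rw [measure_toMeasurable, hB, zero_add]
      exact ENNReal.tsum_le_tsum fun i => (hUε i).le
    _ < 1 := hεsum
  have hpos : 0 < volume (Icc (0 : ℝ) 1 \ E) := by
    refine lt_of_lt_of_le ?_ le_measure_sdiff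
    simpa using hElt
  obtain ⟨L, hLsub, hL, hLpos⟩ := (measurableSet_Icc.diff hEmeas).exists_lt_isClosed_of_ne_top
    (measure_ne_top_of_subset sdiff_subset (by simp)) hpos
  have hsupp : volume.restrict L (volume.restrict L).supportᶜ = 0 :=
    Measure.measure_compl_support
  refine ⟨L ∩ (volume.restrict L).support, U, hL.inter Measure.isClosed_support,
    Measure.nonempty_inter_support_of_pos (by simpa using hLpos),
    fun x hx => (hLsub hx.1).1, ?_, fun O hO hne => ?_, fun i => ⟨hU i, ?_⟩⟩
  · exact disjoint_left.2 fun x hx hxB =>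
      (hLsub hx.1).2 (.inl (subset_toMeasurable _ _ hxB))
  · obtain ⟨x, hxO, -, hx⟩ := hne
    have h1 : 0 < volume.restrict L O :=
      (Measure.mem_support_iff_forall x).1 hx O (hO.mem_nhds hxO)
    rw [← measure_inter_conull hsupp, Measure.restrict_apply' hL.measurableSet] at h1
    convert! h1.ne' using 2
    ext; simp only [mem_inter_iff]; tauto
  · ext x
    refine and_congr_left fun hx => ⟨fun hxU => by_contra fun hxG => ?_, fun h => hGU i h⟩
    exact (hLsub hx.1).2 (.inr (mem_iUnion.2 ⟨i, hxU, hxG⟩))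

/-- A nonzero lower bound on `∏ (1 - r i)` bounds `∑ r i` from above. -/
lemma sum_le_neg_log_of_le_prod {ι : Type*} (s : Finset ι) (r : ι → unitInterval) {c : ℝ≥0∞} (hc : c ≠ 0)
    (h : c ≤ ∏ i ∈ s, ENNReal.ofReal (1 - r i)) :
    ∑ i ∈ s, ENNReal.ofReal (r i) ≤ ENNReal.ofReal (-Real.log c.toReal) := by
  rw [← ENNReal.ofReal_prod_of_nonneg fun i _ => sub_nonneg.2 (r i).2.2] at h
  rw [← ENNReal.ofReal_sum_of_nonneg fun i _ => (r i).2.1]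
  have hexp : ∏ i ∈ s, (1 - (r i : ℝ)) ≤ Real.exp (-∑ i ∈ s, (r i : ℝ)) := by
    rw [← Finset.sum_neg_distrib, Real.exp_sum]
    exact Finset.prod_le_prod (fun i _ => sub_nonneg.2 (r i).2.2)
      fun i _ => Real.one_sub_le_exp_neg _
  have hc' : c ≠ ∞ := ne_top_of_le_ne_top ofReal_ne_top h
  have hle : c.toReal ≤ Real.exp (-∑ i ∈ s, (r i : ℝ)) :=
    (ENNReal.toReal_le_of_le_ofReal (Finset.prod_nonneg fun i _ => sub_nonneg.2 (r i).2.2)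
      h).trans hexp
  have := (Real.log_le_iff_le_exp (ENNReal.toReal_pos hc hc')).2 hle
  exact ENNReal.ofReal_le_ofReal (by linarith)

/-- The second coordinate of `i`, clipped to `[0, 1]`. -/
noncomputable def ratProb (i : ℕ × ℚ) : unitInterval :=
  projIcc 0 1 zero_le_one (i.2 : ℝ)

lemma ratProb_apply (q : Cspace) (n : ℕ) :
    (ratProb (n, (q : ℕ → ℚ) n) : ℝ) = (q : ℕ → ℚ) n := by
  have h0 : (0 : ℝ) ≤ (q : ℕ → ℚ) n := by exact_mod_cast (q.2.1 n).le
  have h1 : ((q : ℕ → ℚ) n : ℝ) ≤ 1 := by exact_mod_cast by simpa using q.2.2 {n}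
  simp [ratProb, projIcc_of_mem zero_le_one (⟨h0, h1⟩ : _ ∈ Icc (0 : ℝ) 1)]

/-- The points lying in infinitely many of the sets `G (n, q n)`. -/
def limsupAlong (G : ℕ × ℚ → Set ℝ) (q : Cspace) : Set ℝ :=
  {x | ∃ᶠ n in atTop, x ∈ G (n, (q : ℕ → ℚ) n)}

lemma volume_limsupAlong {G : ℕ × ℚ → Set ℝ}
    (hG : ∀ i, volume (G i) = ENNReal.ofReal (ratProb i)) (q : Cspace) :
    volume (limsupAlong G q) = 0 := by
  refine measure_setOfPred_frequently_eq_zero (ne_top_of_le_ne_top one_ne_top ?_)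
  simpa [hG, ratProb_apply] using tsum_ofReal_le_one q

/-- By the Baire category theorem, a limsup of relatively open sets that misses a closed set `K`
misses from some point on a nonempty basic relatively open piece of `K`. -/
lemma exists_basic_forall_inter_eq_empty {K : Set ℝ} (hK : IsClosed K) (hne : K.Nonempty)
    {V : ℕ → Set ℝ} (hV : ∀ n, ∃ U, IsOpen U ∧ U ∩ K = V n ∩ K)
    (hlim : ∀ x ∈ K, ∀ᶠ n in atTop, x ∉ V n) :
    ∃ O ∈ TopologicalSpace.countableBasis ℝ, (O ∩ K).Nonempty ∧
      ∀ᶠ n in atTop, O ∩ K ∩ V n = ∅ := by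
  choose U hU hUV using hV
  have : CompleteSpace K := hK.completeSpace_coe
  have : Nonempty K := hne.to_subtype
  have hiff n (x : K) : (x : ℝ) ∈ U n ↔ (x : ℝ) ∈ V n := by
    simpa using Set.ext_iff.1 (hUV n) x
  obtain ⟨N, x, hx⟩ := nonempty_interior_of_iUnion_of_closed
    (f := fun N => {x : K | ∀ n ≥ N, (x : ℝ) ∉ U n})
    (fun N => by
      simp only [ofPred_forall]
      exact isClosed_iInter fun n => isClosed_iInter fun _ =>
        (hU n).isClosed_compl.preimage continuous_subtype_val)
    (eq_univ_of_forall fun x => by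
      obtain ⟨N, hN⟩ := eventually_atTop.1 (hlim x x.2)
      exact mem_iUnion.2 ⟨N, fun n hn hxU => hN n hn ((hiff n x).1 hxU)⟩)
  obtain ⟨T, hT, hTo, hxT⟩ := mem_interior.1 hx
  obtain ⟨T, hT', rfl⟩ := isOpen_induced_iff.1 hTo
  obtain ⟨O, hO, hxO, hOT⟩ :=
    (TopologicalSpace.isBasis_countableBasis ℝ).exists_subset_of_mem_open hxT hT'
  refine ⟨O, hO, ⟨x, hxO, x.2⟩, ?_⟩
  filter_upwards [eventually_ge_atTop N] with n hn
  refine eq_empty_of_forall_notMem fun y ⟨⟨hyO, hyK⟩, hyV⟩ => ?_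
  exact hT (show (⟨y, hyK⟩ : K) ∈ Subtype.val ⁻¹' T from hOT hyO) n hn
    ((hiff n ⟨y, hyK⟩).2 hyV)

lemma exists_cspace_forall_subset_R1 {G : ℕ × ℚ → Set ℝ} (hG : ∀ i, MeasurableSet (G i))
    (hGvol : ∀ i, volume (G i) = ENNReal.ofReal (ratProb i))
    (hGind : ∀ (s : Finset (ℕ × ℚ)) (W : Set ℝ), W ⊆ Icc 0 1 → (∀ i ∈ s, W ∩ G i = ∅) →
      volume W ≤ ∏ i ∈ s, ENNReal.ofReal (1 - ratProb i))
    {B : Set ℝ} (hB : volume B = 0) :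
    ∃ g : Cspace, ∀ q, limsupAlong G q ⊆ B → R1 q g := by
  classical
  obtain ⟨K, U, hK, hKne, hKI, hKB, hKpos, hU⟩ :=
    exists_isClosed_forall_inter_eq hG (fun i => by simp [hGvol i]) hB
  let ι := {O // O ∈ TopologicalSpace.countableBasis ℝ ∧ (O ∩ K).Nonempty}
  have : Countable ι := ((TopologicalSpace.countable_countableBasis ℝ).mono
    fun O hO => hO.1).to_subtype
  let p (O : ι) (i : ℕ × ℚ) : ℝ≥0∞ :=
    if O.1 ∩ K ∩ G i = ∅ then ENNReal.ofReal (ratProb i) else 0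
  have hp (O : ι) : ∑' n, ∑' a, p O (n, a) ≠ ∞ := by
    rw [← ENNReal.tsum_prod', ENNReal.tsum_eq_iSup_sum]
    have hpos := hKpos O.1 (TopologicalSpace.isOpen_of_mem_countableBasis O.2.1) O.2.2
    refine ne_top_of_le_ne_top
      (ofReal_ne_top (r := -Real.log (volume (O.1 ∩ K)).toReal)) (iSup_le fun s => ?_)
    rw [← Finset.sum_filter]
    exact sum_le_neg_log_of_le_prod _ _ hpos (hGind _ _ (inter_subset_right.trans hKI)
      fun i hi => (Finset.mem_filter.1 hi).2)
  obtain ⟨g, hg⟩ := exists_cspace_eventually_ge (fun (O : ι) n => ∑' a, p O (n, a)) hp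
  refine ⟨g, fun q hq => ?_⟩
  obtain ⟨O, hO, hOK, hOG⟩ := exists_basic_forall_inter_eq_empty hK hKne
    (V := fun n => G (n, (q : ℕ → ℚ) n)) (fun n => ⟨_, hU _⟩)
    (fun x hx => not_frequently.1 fun h => disjoint_left.1 hKB hx (hq h))
  filter_upwards [hOG, hg ⟨O, hO, hOK⟩] with n hn hgn
  have hle : ENNReal.ofReal ((q : ℕ → ℚ) n) ≤ ENNReal.ofReal ((g : ℕ → ℚ) n) := by
    refine le_trans ?_ ((ENNReal.le_tsum ((q : ℕ → ℚ) n)).trans hgn)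
    simp [p, hn, ratProb_apply]
  exact_mod_cast (ENNReal.ofReal_le_ofReal_iff (by exact_mod_cast (g.2.1 n).le)).1 hle

theorem stmt1 : addNull = bR R1 ∧ cofNull = dR R1 := by
  obtain ⟨e⟩ : Nonempty (ℕ ≃ ℕ × ℕ × ℚ × ℚ) := nonempty_equiv_of_countable
  obtain ⟨G, hG, hGvol, hGind⟩ := exists_independent_sets ratProb
  choose φ hφ using fun A : {A : Set ℝ // volume A = 0} => exists_cspace_forall_R1_subset e A.2
  choose ψ hψ using fun B : {B : Set ℝ // volume B = 0} =>
    exists_cspace_forall_subset_R1 hG hGvol hGind B.2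
  rw [addNull_eq_bR, cofNull_eq_dR]
  exact bR_eq_and_dR_eq_of_tukey (φ := φ) (ψ := fun g => ⟨_, volume_nullOfCspace e g⟩)
    (φ' := fun q => ⟨_, volume_limsupAlong hGvol q⟩) (ψ' := ψ)
    (fun A g h => hφ A g h) (fun q B h => hψ B q h) (fun A => Subset.rfl)
    (fun q => Eventually.of_forall fun n => le_rfl) ⟨_, rUnbounded_nullSubset_univ⟩
end

section
/- cov(N) ≤ 𝔟_{R₂} and 𝔡_{R₂} ≤ non(N), where the null ideal is that of the product measure on Cantor space 2^ℕ. -/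
open Cardinal MeasureTheory Filter

/-- The partition of `ℕ` into consecutive intervals `I n` with `|I n| = 2 ^ (n + 1)`. -/
def Ipart (n : ℕ) : Finset ℕ := Finset.Ico (2 ^ (n + 1) - 2) (2 ^ (n + 2) - 2)

/-- The relation `R₂` on Cantor space: `f R₂ g` iff for all but finitely many `n`
the restrictions `f ↾ I n` and `g ↾ I n` differ. -/
def R2 (f g : ℕ → Bool) : Prop :=
  ∀ᶠ n in atTop, ∃ m ∈ Ipart n, f m ≠ g m

/-- `cov(N)` for a measure `μ` on Cantor space: the least cardinality of a family of
`μ`-measure-zero sets covering the space. -/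
noncomputable def covNullOf (μ : Measure (ℕ → Bool)) : Cardinal :=
  sInf { c | ∃ F : Set (Set (ℕ → Bool)),
    (∀ A ∈ F, μ A = 0) ∧ ⋃₀ F = Set.univ ∧ #F = c }

/-- `non(N)` for a measure `μ` on Cantor space: the least cardinality of a set that is
not of `μ`-measure zero. -/
noncomputable def nonNullOf (μ : Measure (ℕ → Bool)) : Cardinal :=
  sInf { c | ∃ X : Set (ℕ → Bool), μ X ≠ 0 ∧ #X = c }

theorem not_R2_self (f : ℕ → Bool) : ¬ R2 f f := fun h => by
  obtain ⟨n, m, -, hne⟩ := h.exists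
  exact hne rfl

theorem le_card_Ipart (n : ℕ) : n ≤ (Ipart n).card := by
  have h : n < 2 ^ n := Nat.lt_two_pow_self
  rw [Ipart, Nat.card_Ico, pow_succ, pow_succ]
  omega

/-- By Borel–Cantelli, almost every `g` satisfies `f R₂ g`. -/
theorem measure_not_R2_eq_zero {μ : Measure (ℕ → Bool)}
    (hμ : ∀ s : Finset ℕ, ∀ y : ℕ → Bool,
      μ { f | ∀ i ∈ s, f i = y i } = (2 : ENNReal)⁻¹ ^ s.card) (f : ℕ → Bool) :
    μ { g | ¬ R2 f g } = 0 := by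
  have hsum : ∑' n, μ { g | ∀ i ∈ Ipart n, g i = f i } ≠ ⊤ := by
    refine ne_top_of_le_ne_top (b := ∑' n : ℕ, (2 : ENNReal)⁻¹ ^ n) ?_ ?_
    · rw [ENNReal.tsum_geometric, ENNReal.one_sub_inv_two, inv_inv]
      exact ENNReal.ofNat_ne_top
    · refine ENNReal.tsum_le_tsum fun n => ?_
      rw [hμ]
      exact pow_le_pow_right_of_le_one' (by simp) (le_card_Ipart n)
  refine measure_mono_null (fun g hg => ?_) (measure_setOfPred_frequently_eq_zero hsum)
  refine (not_eventually.mp hg).mono fun n hn i hi => ?_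
  by_contra hne
  exact hn ⟨i, hi, fun h => hne h.symm⟩

/-- Statement 2, for the product of the uniform probability measures on `{0,1}`,
characterized by its values on cylinders. -/
theorem stmt2 (μ : Measure (ℕ → Bool))
    (hμ : ∀ s : Finset ℕ, ∀ y : ℕ → Bool,
      μ { f | ∀ i ∈ s, f i = y i } = (2 : ENNReal)⁻¹ ^ s.card) :
    covNullOf μ ≤ bR R2 ∧ dR R2 ≤ nonNullOf μ := by
  have hnull := measure_not_R2_eq_zero hμ
  constructor
  · refine le_csInf ⟨_, Set.univ, ?_, rfl⟩ ?_
    · rintro ⟨g, hg⟩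
      exact not_R2_self g (hg g trivial)
    · rintro _ ⟨F, hF, rfl⟩
      refine le_trans (csInf_le' ?_) (mk_image_le (f := fun f => { g | ¬ R2 f g }) (s := F))
      refine ⟨_, ?_, ?_, rfl⟩
      · rintro _ ⟨f, -, rfl⟩
        exact hnull f
      · refine Set.eq_univ_of_forall fun g => ?_
        by_contra hg
        refine hF ⟨g, fun f hf => ?_⟩
        by_contra hfg
        exact hg (Set.mem_sUnion.mpr ⟨_, ⟨f, hf, rfl⟩, hfg⟩)
  · refine le_csInf ⟨_, Set.univ, ?_, rfl⟩ ?_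
    · have huniv := hμ ∅ fun _ => false
      simp only [Finset.notMem_empty, false_imp_iff, implies_true, Set.ofPred_true,
        Finset.card_empty, pow_zero] at huniv
      simp [huniv]
    · rintro _ ⟨X, hX, rfl⟩
      refine csInf_le' ⟨X, fun f => ?_, rfl⟩
      by_contra! h
      exact hX (measure_mono_null h (hnull f))
end

section
/- non(M) = 𝔟_{R₄} and cov(M) = 𝔡_{R₄}, where the meager ideal is that of Baire space ℕ^ℕ. -/
open Cardinal Filter

/-- The relation `R₄` on Baire space: eventual difference. -/
def R4 (f g : ℕ → ℕ) : Prop := ∀ᶠ n in atTop, f n ≠ g n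

/-- `non(M)`: the least cardinality of a non-meager subset of Baire space. -/
noncomputable def nonMeagre : Cardinal :=
  sInf { c | ∃ X : Set (ℕ → ℕ), ¬ IsMeagre X ∧ #X = c }

/-- `cov(M)`: the least cardinality of a family of meager sets covering Baire space. -/
noncomputable def covMeagre : Cardinal :=
  sInf { c | ∃ F : Set (Set (ℕ → ℕ)),
    (∀ A ∈ F, IsMeagre A) ∧ ⋃₀ F = Set.univ ∧ #F = c }

theorem not_R4_iff {f g : ℕ → ℕ} : ¬ R4 f g ↔ ∃ᶠ n in atTop, f n = g n := Iff.rfl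

theorem isOpen_setOf_apply_eq (n a : ℕ) : IsOpen {f : ℕ → ℕ | f n = a} :=
  (isOpen_discrete ({a} : Set ℕ)).preimage (continuous_apply (A := fun _ => ℕ) n)

theorem exists_cylinder_subset {U : Set (ℕ → ℕ)} (hU : IsOpen U) {x : ℕ → ℕ} (hx : x ∈ U) :
    ∃ n, PiNat.cylinder x n ⊆ U := by
  obtain ⟨v, ⟨y, n, rfl⟩, hxv, hv⟩ :=
    (PiNat.isTopologicalBasis_cylinders (fun _ : ℕ => ℕ)).exists_subset_of_mem_open hx hU
  exact ⟨n, (PiNat.mem_cylinder_iff_eq.1 hxv).symm ▸ hv⟩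

theorem isMeagre_setOf_R4 (g : ℕ → ℕ) : IsMeagre {f | R4 f g} := by
  have hmem : ∀ N : ℕ, (⋃ n ≥ N, {f : ℕ → ℕ | f n = g n}) ∈ residual (ℕ → ℕ) := by
    intro N
    refine residual_of_dense_open ?_ ?_
    · exact isOpen_biUnion fun n _ => isOpen_setOf_apply_eq n (g n)
    · rw [dense_iff_inter_open]
      rintro U hU ⟨x, hx⟩
      obtain ⟨n, hn⟩ := exists_cylinder_subset hU hx
      refine ⟨Function.update x (max n N) (g (max n N)), hn fun i hi => ?_, ?_⟩
      · exact Function.update_of_ne (by omega) _ _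
      · simp only [Set.mem_iUnion]
        exact ⟨max n N, le_max_right _ _, by simp⟩
  refine mem_of_superset (countable_iInter_mem.2 hmem) fun f hf => ?_
  refine not_R4_iff.2 (frequently_atTop.2 fun N => ?_)
  simpa using Set.mem_iInter.1 hf N

/-- A single map turning functions that guess infinitely often into functions that guess
infinitely often along a prescribed infinite set. -/
theorem exists_guess_along_infinite :
    ∃ star : (ℕ → ℕ) → ℕ → ℕ, ∀ (X : Set ℕ) (f : ℕ → ℕ), X.Infinite →
      ∃ f' : ℕ → ℕ, ∀ g, (∃ᶠ n in atTop, g n = f' n) →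
        ∃ᶠ k in atTop, k ∈ X ∧ star g k = f k := by
  classical
  have hstar : ∀ g : ℕ → ℕ, ∃ G : ℕ → ℕ, ∀ n, ∀ t : Finset (ℕ × ℕ),
      g n = Denumerable.eqv (Finset (ℕ × ℕ)) t → n < (t.image Prod.fst).card → ∃ e ∈ t, G e.1 = e.2 := by
    intro g
    let step : ℕ → Finset (ℕ × ℕ) → Finset (ℕ × ℕ) := fun n K =>
      if h : ∃ e ∈ (Denumerable.eqv (Finset (ℕ × ℕ))).symm (g n), e.1 ∉ K.image Prod.fst then
        insert h.choose K else K
    obtain ⟨K, hzero, hsucc⟩ : ∃ K : ℕ → Finset (ℕ × ℕ), K 0 = ∅ ∧ ∀ n, K (n + 1) = step n (K n) :=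
      ⟨fun n => Nat.rec ∅ step n, rfl, fun _ => rfl⟩
    have hmono : Monotone K := monotone_nat_of_le_succ fun n => by
      rw [hsucc]
      simp only [step]
      split_ifs
      · exact Finset.subset_insert _ _
      · exact le_rfl
    have hcard : ∀ n, (K n).card ≤ n := by
      intro n
      induction n with
      | zero => simp [hzero]
      | succ n ih =>
        rw [hsucc]
        simp only [step]
        split_ifs
        · exact (Finset.card_insert_le _ _).trans (by omega)
        · omega
    have hinj : ∀ n : ℕ, Set.InjOn Prod.fst (K n : Set (ℕ × ℕ)) := by
      intro n
      induction n with
      | zero => simp [hzero]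
      | succ n ih =>
        rw [hsucc]
        simp only [step]
        split_ifs with h
        · have hnew := h.choose_spec.2
          rw [Finset.coe_insert, Set.injOn_insert]
          · exact ⟨ih, by simpa using hnew⟩
          · exact fun hc => hnew (Finset.mem_image_of_mem _ hc)
        · exact ih
    refine ⟨fun k => if h : ∃ v n, (k, v) ∈ K n then h.choose else 0, fun n t ht hn => ?_⟩
    have hex : ∃ e ∈ (Denumerable.eqv (Finset (ℕ × ℕ))).symm (g n), e.1 ∉ (K n).image Prod.fst := by
      rw [ht, Equiv.symm_apply_apply]
      by_contra! hc
      have hsub : t.image Prod.fst ⊆ (K n).image Prod.fst := by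
        intro k hk
        obtain ⟨e, he, rfl⟩ := Finset.mem_image.1 hk
        exact hc e he
      have := (Finset.card_le_card hsub).trans (Finset.card_image_le.trans (hcard n))
      omega
    have hmem : hex.choose ∈ K (n + 1) := by
      rw [hsucc]
      simp only [step]
      rw [dif_pos hex]
      exact Finset.mem_insert_self _ _
    refine ⟨hex.choose, ?_, ?_⟩
    · simpa only [ht, Equiv.symm_apply_apply] using hex.choose_spec.1
    · generalize hex.choose = e at hmem
      have h : ∃ v n, (e.1, v) ∈ K n := ⟨e.2, n + 1, hmem⟩
      obtain ⟨n', hn'⟩ := h.choose_spec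
      simp only [dif_pos h]
      exact congrArg Prod.snd (hinj (max n' (n + 1)) (hmono (le_max_left _ _) hn')
        (hmono (le_max_right _ _) hmem) rfl)
  choose star hstar using hstar
  refine ⟨star, fun X f hX => ?_⟩
  have hfin : ∀ n : ℕ, ∃ t : Finset ℕ, (t : Set ℕ) ⊆ X \ Set.Iio n ∧ t.card = n + 1 := fun n =>
    (hX.sdiff (Set.finite_Iio n)).exists_subset_card_eq (n + 1)
  choose t ht htcard using hfin
  refine ⟨fun n => Denumerable.eqv (Finset (ℕ × ℕ)) ((t n).image fun k => (k, f k)), fun g hg => ?_⟩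
  rw [frequently_atTop] at hg ⊢
  intro N
  obtain ⟨n, hNn, hn⟩ := hg N
  obtain ⟨e, he, hGe⟩ := hstar g n _ hn (by
    rw [Finset.image_image, Finset.card_image_of_injective _ fun _ _ h => by exact h, htcard]
    omega)
  obtain ⟨k, hk, rfl⟩ := Finset.mem_image.1 he
  obtain ⟨hkX, hkn⟩ := ht n hk
  exact ⟨k, by simp at hkn; omega, hkX, hGe⟩

/-- A single map turning functions that guess infinitely often into increasing functions that
infinitely often make a big jump. -/
theorem exists_fast_jumps :
    ∃ H : (ℕ → ℕ) → ℕ → ℕ, (∀ h, Monotone (H h) ∧ ∀ n, n ≤ H h n) ∧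
      ∀ m : ℕ → ℕ, Monotone m → ∃ u : ℕ → ℕ, ∀ h, (∃ᶠ n in atTop, h n = u n) →
        ∃ᶠ n in atTop, m (H h n) ≤ H h (n + 1) := by
  refine ⟨fun h n => n + ∑ i ∈ Finset.range (n + 1), h i,
    fun h => ⟨?_, fun n => Nat.le_add_right _ _⟩, ?_⟩
  · exact monotone_nat_of_le_succ fun n => by dsimp only; rw [Finset.sum_range_succ _ (n + 1)]; omega
  intro m hm
  refine ⟨fun n => (Finset.range (n + 1) ×ˢ Finset.range (n + 1)).sup
    (fun q => m^[q.1] q.2) + 1, fun h hh => ?_⟩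
  set H : ℕ → ℕ := fun n => n + ∑ i ∈ Finset.range (n + 1), h i
  change ∃ᶠ n in atTop, m (H n) ≤ H (n + 1)
  by_contra hc
  obtain ⟨N, hN⟩ := eventually_atTop.1 (not_frequently.1 hc)
  have hiter : ∀ j, H (N + j) ≤ m^[j] (H N) := by
    intro j
    induction j with
    | zero => rfl
    | succ j ih =>
      rw [Function.iterate_succ_apply']
      exact (not_le.1 (hN (N + j) (by omega))).le.trans (hm ih)
  obtain ⟨n, hn, hun⟩ := frequently_atTop.1 hh (max N (H N))
  have hle : h n ≤ H n := by
    simp only [H, Finset.sum_range_succ]; omega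
  have hsup : m^[n - N] (H N) ≤ (Finset.range (n + 1) ×ˢ Finset.range (n + 1)).sup
      (fun q => m^[q.1] q.2) :=
    Finset.le_sup (f := fun q : ℕ × ℕ => m^[q.1] q.2) (b := (n - N, H N)) (by simp; omega)
  have := hiter (n - N)
  rw [Nat.add_sub_cancel' (by omega)] at this
  dsimp only at hun
  omega

/-- The sequences extending a given finite sequence. -/
def listCylinder (p : List ℕ) : Set (ℕ → ℕ) := {x | ∀ i a, p[i]? = some a → x i = a}

theorem isOpen_listCylinder (p : List ℕ) : IsOpen (listCylinder p) := by
  have : listCylinder p = ⋂ i : Fin p.length, {x : ℕ → ℕ | x i = p[i]} := by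
    ext x
    simp only [listCylinder, List.getElem?_eq_some_iff, Set.mem_ofPred_eq, Set.mem_iInter]
    exact ⟨fun h i => h i _ ⟨i.2, rfl⟩, fun h i a ⟨hi, ha⟩ => ha ▸ h ⟨i, hi⟩⟩
  rw [this]
  exact isOpen_iInter_of_finite fun i => isOpen_setOf_apply_eq i p[i]

theorem listCylinder_nonempty (p : List ℕ) : (listCylinder p).Nonempty :=
  ⟨fun i => p[i]?.getD 0, fun i a h => by simp [h]⟩

theorem Dense.exists_extension_listCylinder_subset {U : Set (ℕ → ℕ)} (hd : Dense U) (hU : IsOpen U)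
    (p : List ℕ) : ∃ q, p <+: q ∧ listCylinder q ⊆ U := by
  obtain ⟨x, hxp, hxU⟩ := hd.inter_open_nonempty _ (isOpen_listCylinder p)
    (listCylinder_nonempty p)
  obtain ⟨n, hn⟩ := exists_cylinder_subset hU hxU
  refine ⟨(List.range (max n p.length)).map x, ?_, fun y hy => hn fun i hi => ?_⟩
  · rw [List.prefix_iff_getElem]
    refine ⟨by simp, fun i hi => ?_⟩
    simpa using (hxp i _ (List.getElem?_eq_getElem hi)).symm
  · exact hy i _ (by simp [hi])

theorem exists_mem_listCylinder_of_chain {L : ℕ → List ℕ} (hL : ∀ n, L n <+: L (n + 1)) :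
    ∃ x, ∀ n, x ∈ listCylinder (L n) := by
  classical
  have hmono : ∀ {m n}, m ≤ n → L m <+: L n := fun {m n} h => by
    induction n, h using Nat.le_induction with
    | base => exact List.prefix_rfl
    | succ n _ ih => exact ih.trans (hL n)
  have hget : ∀ {m n i a}, m ≤ n → (L m)[i]? = some a → (L n)[i]? = some a :=
    fun {m n i a} h ha => by
      obtain ⟨s, hs⟩ := hmono h
      rw [← hs, List.getElem?_append_left (List.getElem?_eq_some_iff.1 ha).1, ha]
  refine ⟨fun i => if h : ∃ a n, (L n)[i]? = some a then h.choose else 0, fun n i a ha => ?_⟩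
  have h : ∃ a n, (L n)[i]? = some a := ⟨a, n, ha⟩
  obtain ⟨n', hn'⟩ := h.choose_spec
  simp only [dif_pos h]
  exact Option.some_inj.1
    ((hget (le_max_left n' n) hn').symm.trans (hget (le_max_right n' n) ha))

theorem IsMeagre.exists_antitone_dense_open {X : Type*} [TopologicalSpace X] [BaireSpace X]
    {A : Set X} (hA : IsMeagre A) :
    ∃ V : ℕ → Set X, Antitone V ∧ (∀ n, IsOpen (V n)) ∧ (∀ n, Dense (V n)) ∧ ⋂ n, V n ⊆ Aᶜ := by
  obtain ⟨S, hSo, hSd, hSc, hSA⟩ := mem_residual_iff.1 hA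
  obtain ⟨U, hU⟩ := (hSc.insert Set.univ).exists_eq_range (Set.insert_nonempty _ _)
  have hmem : ∀ n, U n ∈ insert Set.univ S := fun n => hU ▸ Set.mem_range_self n
  have hUo : ∀ n, IsOpen (U n) := fun n =>
    (hmem n).elim (fun h => h ▸ isOpen_univ) (hSo _)
  have hUd : ∀ n, Dense (U n) := fun n =>
    (hmem n).elim (fun h => h ▸ dense_univ) (hSd _)
  refine ⟨fun n => ⋂ i ∈ Set.Iic n, U i, fun m n h => ?_, fun n => ?_, fun n => ?_, ?_⟩
  · exact Set.biInter_subset_biInter_left (Set.Iic_subset_Iic.2 h)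
  · exact (Set.finite_Iic n).isOpen_biInter fun i _ => hUo i
  · exact dense_biInter_of_isOpen (fun i _ => hUo i) (Set.to_countable _) fun i _ => hUd i
  · refine fun x hx => hSA fun s hs => ?_
    obtain ⟨n, rfl⟩ : s ∈ Set.range U := hU ▸ Set.mem_insert_of_mem _ hs
    exact Set.mem_iInter₂.1 (Set.mem_iInter.1 hx n) n (Set.mem_Iic.2 le_rfl)

/-- Guesses of extensions, bounded by a function that jumps fast enough, determine a point outside
a given meagre set. -/
theorem exists_point_outside_of_guess :
    ∃ P : (ℕ → ℕ) → (ℕ → ℕ) → ℕ → ℕ, ∀ A : Set (ℕ → ℕ), IsMeagre A →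
      ∃ m T : ℕ → ℕ, Monotone m ∧ ∀ h G, Monotone h → (∀ n, n ≤ h n) →
        (∃ᶠ n in atTop, m (h n) ≤ h (n + 1) ∧ G n = T (h n)) → P h G ∉ A := by
  classical
  let next : ℕ → List ℕ → List ℕ := fun c p =>
    Denumerable.ofNat (List ℕ) ((Denumerable.ofNat (List ℕ) c)[Encodable.encode p]?.getD 0)
  have hP : ∀ h G : ℕ → ℕ, ∃ x : ℕ → ℕ, Monotone h → ∃ L : ℕ → List ℕ,
      (∀ n, Encodable.encode (L n) ≤ h n) ∧ (∀ n, x ∈ listCylinder (L n)) ∧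
      ∀ n, L n <+: next (G n) (L n) → Encodable.encode (next (G n) (L n)) ≤ h (n + 1) →
        L (n + 1) = next (G n) (L n) := by
    intro h G
    let step : ℕ → List ℕ → List ℕ := fun n p =>
      if p <+: next (G n) p ∧ Encodable.encode (next (G n) p) ≤ h (n + 1) then next (G n) p else p
    obtain ⟨L, hzero, hsucc⟩ : ∃ L : ℕ → List ℕ, L 0 = [] ∧ ∀ n, L (n + 1) = step n (L n) :=
      ⟨fun n => Nat.rec [] step n, rfl, fun _ => rfl⟩
    obtain ⟨x, hx⟩ := exists_mem_listCylinder_of_chain (L := L) fun n => by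
      rw [hsucc]
      simp only [step]
      split_ifs with hc
      · exact hc.1
      · exact List.prefix_rfl
    refine ⟨x, fun hmono => ⟨L, fun n => ?_, hx, fun n h₁ h₂ => ?_⟩⟩
    · induction n with
      | zero => simp [hzero]
      | succ n ih =>
        rw [hsucc]
        simp only [step]
        split_ifs with hc
        · exact hc.2
        · exact ih.trans (hmono n.le_succ)
    · rw [hsucc]
      simp only [step]
      rw [if_pos ⟨h₁, h₂⟩]
  choose P hP using hP
  refine ⟨P, fun A hA => ?_⟩
  obtain ⟨V, hVanti, hVo, hVd, hVA⟩ := hA.exists_antitone_dense_open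
  choose φ hφ hφV using fun k => (hVd k).exists_extension_listCylinder_subset (hVo k)
  let code : ℕ → ℕ → ℕ := fun k j => Encodable.encode (φ k (Denumerable.ofNat (List ℕ) j))
  refine ⟨fun k => (Finset.range (k + 1) ×ˢ Finset.range (k + 1)).sup fun q => code q.1 q.2,
    fun k => Encodable.encode ((List.range (k + 1)).map (code k)), fun k l hkl => ?_, ?_⟩
  · have := Finset.range_mono (Nat.succ_le_succ hkl)
    exact Finset.sup_mono (Finset.product_subset_product this this)
  intro h G hmono hle hfreq hmem
  obtain ⟨L, hLh, hxL, hLnext⟩ := hP h G hmono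
  refine hVA (Set.mem_iInter.2 fun N => ?_) hmem
  obtain ⟨n, hNn, hjump, hG⟩ := frequently_atTop.1 hfreq N
  have hnext : next (G n) (L n) = φ (h n) (L n) := by
    have := hLh n
    simp [next, hG, code, Nat.lt_succ_of_le this]
  have hcode : Encodable.encode (φ (h n) (L n)) ≤ h (n + 1) := by
    refine le_trans ?_ hjump
    have := Finset.le_sup (s := Finset.range (h n + 1) ×ˢ Finset.range (h n + 1))
      (f := fun q : ℕ × ℕ => code q.1 q.2) (b := (h n, Encodable.encode (L n)))
      (by have := hLh n; simp; omega)
    simpa [code] using this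
  have hL : L (n + 1) = φ (h n) (L n) :=
    (hLnext n (hnext ▸ hφ _ _) (hnext ▸ hcode)).trans hnext
  exact hVanti (hNn.trans (hle n)) (hφV _ _ (hL ▸ hxL (n + 1)))

/-- Two successive infinitely-often guesses suffice to leave a meagre set. -/
theorem exists_point_outside_of_two_guesses :
    ∃ Φ : (ℕ → ℕ) → (ℕ → ℕ) → ℕ → ℕ, ∀ A : Set (ℕ → ℕ), IsMeagre A →
      ∃ (u : ℕ → ℕ) (v : (ℕ → ℕ) → ℕ → ℕ), ∀ h g, ¬ R4 u h → ¬ R4 (v h) g → Φ h g ∉ A := by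
  obtain ⟨star, hstar⟩ := exists_guess_along_infinite
  obtain ⟨H, hH, hjump⟩ := exists_fast_jumps
  obtain ⟨P, hP⟩ := exists_point_outside_of_guess
  refine ⟨fun h g => P (H h) (star g), fun A hA => ?_⟩
  obtain ⟨m, T, hm, hPA⟩ := hP A hA
  obtain ⟨u, hu⟩ := hjump m hm
  have hv : ∀ h, ∃ v : ℕ → ℕ, ¬ R4 u h → ∀ g, ¬ R4 v g → P (H h) (star g) ∉ A := by
    intro h
    by_cases hh : R4 u h
    · exact ⟨0, fun hc => absurd hh hc⟩
    have hX := Nat.frequently_atTop_iff_infinite.1 (hu h ((not_R4_iff.1 hh).mono fun _ => Eq.symm))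
    obtain ⟨v, hv⟩ := hstar _ (fun n => T (H h n)) hX
    exact ⟨v, fun _ g hg => hPA _ _ (hH h).1 (hH h).2
      (hv g ((not_R4_iff.1 hg).mono fun _ => Eq.symm))⟩
  choose v hv using hv
  exact ⟨u, v, fun h g hh => hv h hh g⟩

theorem R4.symm {f g : ℕ → ℕ} (h : R4 f g) : R4 g f := h.mono fun _ => Ne.symm

theorem R4_succ (f : ℕ → ℕ) : R4 f fun n => f n + 1 :=
  Eventually.of_forall fun n => (Nat.lt_succ_self (f n)).ne

theorem RUnbounded.aleph0_le {F : Set (ℕ → ℕ)} (hF : RUnbounded R4 F) : ℵ₀ ≤ #F := by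
  by_contra! hc
  have hfin : F.Finite := Cardinal.lt_aleph0_iff_set_finite.1 hc
  refine hF ⟨fun n => hfin.toFinset.sup (fun f => f n) + 1, fun f hf => ?_⟩
  refine Eventually.of_forall fun n => ?_
  have : f n ≤ hfin.toFinset.sup fun f => f n :=
    Finset.le_sup (f := fun f : ℕ → ℕ => f n) (hfin.mem_toFinset.2 hf)
  dsimp only
  omega

theorem rUnbounded_R4_univ : RUnbounded R4 Set.univ := fun ⟨g, hg⟩ =>
  (hg g trivial).exists.elim fun _ h => h rfl

theorem rUnbounded_R4_of_not_isMeagre {X : Set (ℕ → ℕ)} (hX : ¬ IsMeagre X) :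
    RUnbounded R4 X := fun ⟨g, hg⟩ => hX ((isMeagre_setOf_R4 g).mono hg)

theorem RUnbounded.exists_not_isMeagre {F : Set (ℕ → ℕ)} (hF : RUnbounded R4 F) :
    ∃ X : Set (ℕ → ℕ), ¬ IsMeagre X ∧ #X ≤ #F := by
  obtain ⟨Φ, hΦ⟩ := exists_point_outside_of_two_guesses
  refine ⟨Set.range fun q : F × F => Φ q.1 q.2, fun hX => ?_, ?_⟩
  · obtain ⟨u, v, huv⟩ := hΦ _ hX
    have hguess : ∀ g, ∃ f ∈ F, ¬ R4 g f := fun g => by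
      by_contra! hc
      exact hF ⟨g, fun f hf => (hc f hf).symm⟩
    obtain ⟨h, hhF, hh⟩ := hguess u
    obtain ⟨g, hgF, hg⟩ := hguess (v h)
    exact huv h g hh hg ⟨(⟨h, hhF⟩, ⟨g, hgF⟩), rfl⟩
  · calc #(Set.range fun q : F × F => Φ q.1 q.2) ≤ #(F × F) := mk_range_le
      _ = #F * #F := by simp
      _ = #F := mul_eq_self hF.aleph0_le

theorem RDominating.exists_cover {D : Set (ℕ → ℕ)} (hD : RDominating R4 D) :
    ∃ C : Set (Set (ℕ → ℕ)), (∀ A ∈ C, IsMeagre A) ∧ ⋃₀ C = Set.univ ∧ #C ≤ #D := by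
  refine ⟨(fun g => {f | R4 f g}) '' D, ?_, ?_, mk_image_le⟩
  · rintro _ ⟨g, -, rfl⟩
    exact isMeagre_setOf_R4 g
  · refine Set.eq_univ_of_forall fun f => ?_
    obtain ⟨g, hg, hfg⟩ := hD f
    exact ⟨_, ⟨g, hg, rfl⟩, hfg⟩

theorem exists_rDominating_of_cover {C : Set (Set (ℕ → ℕ))} (hC : ∀ A ∈ C, IsMeagre A)
    (hcover : ⋃₀ C = Set.univ) : ∃ D : Set (ℕ → ℕ), RDominating R4 D ∧ #D ≤ #C := by
  obtain ⟨Φ, hΦ⟩ := exists_point_outside_of_two_guesses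
  choose u v huv using fun A : C => hΦ A (hC A A.2)
  by_contra! hsmall
  have hguess : ∀ w : C → ℕ → ℕ, ∃ h, ∀ A, ¬ R4 (w A) h := by
    intro w
    by_contra! hc
    refine (hsmall (Set.range w) fun f => ?_).not_ge mk_range_le
    obtain ⟨A, hA⟩ := hc f
    exact ⟨w A, ⟨A, rfl⟩, hA.symm⟩
  obtain ⟨h, hh⟩ := hguess u
  obtain ⟨g, hg⟩ := hguess fun A => v A h
  obtain ⟨A, hA, hmem⟩ : Φ h g ∈ ⋃₀ C := hcover ▸ Set.mem_univ _
  exact huv ⟨A, hA⟩ h g (hh _) (hg _) hmem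

theorem stmt3 : nonMeagre = bR R4 ∧ covMeagre = dR R4 := by
  refine ⟨le_antisymm (le_csInf ⟨_, _, rUnbounded_R4_univ, rfl⟩ ?_) (le_csInf ?_ ?_),
    le_antisymm (le_csInf ⟨_, Set.univ, fun f => ⟨_, trivial, R4_succ f⟩, rfl⟩ ?_)
      (le_csInf ?_ ?_)⟩
  · rintro _ ⟨F, hF, rfl⟩
    obtain ⟨X, hX, hle⟩ := hF.exists_not_isMeagre
    exact le_trans (csInf_le' ⟨X, hX, rfl⟩) hle
  · obtain ⟨X, hX, -⟩ := rUnbounded_R4_univ.exists_not_isMeagre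
    exact ⟨_, X, hX, rfl⟩
  · rintro _ ⟨X, hX, rfl⟩
    exact csInf_le' ⟨X, rUnbounded_R4_of_not_isMeagre hX, rfl⟩
  · rintro _ ⟨D, hD, rfl⟩
    obtain ⟨C, hC, hcover, hle⟩ := hD.exists_cover
    exact le_trans (csInf_le' ⟨C, hC, hcover, rfl⟩) hle
  · obtain ⟨C, hC, hcover, -⟩ :=
      RDominating.exists_cover (D := Set.univ) fun f => ⟨_, trivial, R4_succ f⟩
    exact ⟨_, C, hC, hcover, rfl⟩
  · rintro _ ⟨C, hC, hcover, rfl⟩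
    obtain ⟨D, hD, hle⟩ := exists_rDominating_of_cover hC hcover
    exact le_trans (csInf_le' ⟨D, hD, rfl⟩) hle
end

section
/- (Engelking–Karłowicz) Let χ be an infinite cardinal with χ^ℵ₀ = χ, let I be a set with |I| ≤ 2^χ, and let T be a nonempty set with |T| ≤ χ. Then there is a family H of functions from I to T with |H| ≤ χ such that every function from a countable subset of I into T is extended by some member of H. -/
open Cardinal

universe u

namespace EngelkingKarlowicz

/-- A code for a function `I → T`: a countable family of separating points of `K`, a sequence of
membership patterns on these points, and the values attached to the patterns. -/
abbrev Code (K T : Type u) : Type u :=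
  (ℕ × ℕ → K) × (ℕ × ℕ × ℕ → ULift.{u} Prop) × (ℕ → T)

open Classical in
/-- The function coded by `c`, relative to `e : I → Set K`: a point `x` takes the value attached to
some pattern that `e x` realizes, if there is one. -/
noncomputable def decode {I K T : Type u} [Nonempty T] (e : I → Set K) (c : Code K T) (x : I) : T :=
  if hx : ∃ n, ∀ k, c.1 k ∈ e x ↔ (c.2.1 (n, k)).down then c.2.2 hx.choose
  else Classical.arbitrary T

theorem mk_code_le {K T : Type u} {χ : Cardinal.{u}} (hχ : ℵ₀ ≤ χ) (hpow : χ ^ ℵ₀ = χ)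
    (hK : #K = χ) (hT : #T ≤ χ) : #(Code K T) ≤ χ := by
  have hseq (J : Type) (S : Type u) [Countable J] [Infinite J] (hS : #S ≤ χ) : #(J → S) ≤ χ := by
    rw [mk_arrow, mk_eq_aleph0 J]
    simpa [hpow] using power_le_power_right (c := ℵ₀) hS
  have hP : #(ULift.{u} Prop) ≤ χ := by
    rw [mk_uLift, mk_Prop, lift_ofNat]
    exact (natCast_lt_aleph0 (n := 2)).le.trans hχ
  rw [Code, mk_prod, mk_prod, lift_id, lift_id, lift_id, lift_id]
  exact mul_le_of_le hχ (hseq _ _ hK.le) (mul_le_of_le hχ (hseq _ _ hP) (hseq _ _ hT))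

theorem exists_decode_eq {I K T : Type u} [Nonempty K] [Nonempty T] {e : I → Set K}
    (he : Function.Injective e) {A : Set I} (hA : A.Countable) (f : A → T) :
    ∃ c : Code K T, ∀ a : A, decode e c a = f a := by
  rcases isEmpty_or_nonempty A with hE | hE
  · exact ⟨Classical.arbitrary _, fun a => hE.elim a⟩
  have := hA.to_subtype
  obtain ⟨a, ha⟩ := exists_surjective_nat A
  have hsep (k : ℕ × ℕ) : ∃ p : K, (p ∈ e (a k.1) ↔ p ∈ e (a k.2)) → a k.1 = a k.2 := by
    by_contra! h
    exact (h (Classical.arbitrary K)).2 (Subtype.ext (he (Set.ext fun p => (h p).1)))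
  choose s hs using hsep
  refine ⟨(s, fun q => ⟨s q.2 ∈ e (a q.1)⟩, fun n => f (a n)), fun x => ?_⟩
  obtain ⟨m, rfl⟩ := ha x
  have hx : ∃ n, ∀ k, s k ∈ e (a m) ↔ s k ∈ e (a n) := ⟨m, fun _ => Iff.rfl⟩
  rw [decode, dif_pos hx]
  exact congrArg f (hs (m, hx.choose) (hx.choose_spec _)).symm

end EngelkingKarlowicz

open EngelkingKarlowicz in
/-- Engelking–Karłowicz theorem on the density of box products. -/
theorem stmt12 {I T : Type u} (χ : Cardinal.{u}) (hχ : ℵ₀ ≤ χ)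
    (hpow : χ ^ ℵ₀ = χ) (hI : #I ≤ 2 ^ χ) (hT : Nonempty T) (hTc : #T ≤ χ) :
    ∃ H : Set (I → T), #H ≤ χ ∧
      ∀ A : Set I, A.Countable → ∀ f : A → T, ∃ h ∈ H, ∀ a : A, h ↑a = f a := by
  have hK : #χ.out = χ := mk_out χ
  have : Nonempty χ.out := mk_ne_zero_iff.1 (hK.trans_ne (aleph0_pos.trans_le hχ).ne')
  obtain ⟨e⟩ : Nonempty (I ↪ Set χ.out) := by
    rwa [← le_def, mk_set, hK]
  refine ⟨Set.range (decode e), mk_range_le.trans (mk_code_le hχ hpow hK hTc), fun A hA f => ?_⟩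
  obtain ⟨c, hc⟩ := exists_decode_eq e.injective hA f
  exact ⟨_, ⟨c, rfl⟩, hc⟩
end

section
/- Let D be an ultrafilter on ℕ and let (p_n)_{n∈ℕ} = ((s,k,φ_n))_{n∈ℕ} be a sequence of conditions of 𝔼 all having the same stem (s,k). Let lim_D p̄ = (s,k,φ_∞) where φ_∞(i) = { j : { n : j ∈ φ_n(i) } ∈ D }. Then lim_D p̄ is a condition of 𝔼, and for every condition q ≤ lim_D p̄ and every A ∈ D there is n ∈ A such that q and p_n have a common lower bound in 𝔼. -/
/-- A condition of eventually different forcing `𝔼`: a triple `(s, k, φ)` with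
`φ : ℕ → [ℕ]^{≤k}` and `s i ∉ φ i` for `i` in the domain of `s`. -/
structure EDCond : Type where
  s : List ℕ
  k : ℕ
  φ : ℕ → Finset ℕ
  card_le : ∀ i, (φ i).card ≤ k
  stem_not_mem : ∀ i : Fin s.length, s.get i ∉ φ i.val

/-- The order on `𝔼`: `q ≤ p` iff `p.s` is an initial segment of `q.s`,
`p.k ≤ q.k`, and `p.φ i ⊆ q.φ i` for all `i`. -/
def EDle (q p : EDCond) : Prop :=
  p.s <+: q.s ∧ p.k ≤ q.k ∧ ∀ i, p.φ i ⊆ q.φ i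

/-- If all the sets `f n` have size at most `k`, then so has their `D`-limit. -/
theorem Ultrafilter.exists_finset_limit {ι α : Type*} (D : Ultrafilter ι) (f : ι → Finset α)
    (k : ℕ) (hf : ∀ n, (f n).card ≤ k) :
    ∃ F : Finset α, F.card ≤ k ∧ ∀ j, j ∈ F ↔ { n | j ∈ f n } ∈ D := by
  have key : ∀ F : Finset α, (∀ j ∈ F, { n | j ∈ f n } ∈ D) → F.card ≤ k := by
    intro F hF
    have h : (⋂ j ∈ F, { n | j ∈ f n }) ∈ (D : Filter ι) :=
      (Filter.biInter_finset_mem F).2 hF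
    obtain ⟨n, hn⟩ := D.neBot.nonempty_of_mem h
    exact (Finset.card_le_card fun j hj => Set.mem_iInter₂.1 hn j hj).trans (hf n)
  have hfin : { j | { n | j ∈ f n } ∈ D }.Finite := by
    by_contra h
    obtain ⟨F, hF, hc⟩ := Set.Infinite.exists_subset_card_eq h (k + 1)
    have := key F fun j hj => hF hj
    omega
  exact ⟨hfin.toFinset, key _ fun j hj => by simpa using hj, fun j => by simp⟩

/-- Two conditions are compatible when the sequence of one extends that of the other and
avoids the slalom of the other. -/
theorem EDCond.exists_le_le (r p : EDCond) (hs : p.s <+: r.s)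
    (h : ∀ i : Fin r.s.length, r.s.get i ∉ p.φ i.val) :
    ∃ r' : EDCond, EDle r' r ∧ EDle r' p := by
  refine ⟨⟨r.s, r.k + p.k, fun i => r.φ i ∪ p.φ i, fun i => ?_, fun i hi => ?_⟩,
    ⟨List.prefix_rfl, Nat.le_add_right _ _, fun i => Finset.subset_union_left⟩,
    ⟨hs, Nat.le_add_left _ _, fun i => Finset.subset_union_right⟩⟩
  · exact (Finset.card_union_le _ _).trans (Nat.add_le_add (r.card_le i) (p.card_le i))
  · exact (Finset.mem_union.1 hi).elim (r.stem_not_mem i) (h i)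

theorem stmt14 (D : Ultrafilter ℕ) (s : List ℕ) (k : ℕ) (p : ℕ → EDCond)
    (hstem : ∀ n, (p n).s = s ∧ (p n).k = k) :
    ∃ q : EDCond, q.s = s ∧ q.k = k ∧
      (∀ i j : ℕ, j ∈ q.φ i ↔ { n : ℕ | j ∈ (p n).φ i } ∈ D) ∧
      ∀ r : EDCond, EDle r q → ∀ A : Set ℕ, A ∈ D →
        ∃ n ∈ A, ∃ r' : EDCond, EDle r' r ∧ EDle r' (p n) := by
  choose φ hcard hφ using fun i : ℕ =>
    D.exists_finset_limit (fun n => (p n).φ i) k fun n => (hstem n).2 ▸ (p n).card_le i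
  have hstem_not_mem : ∀ i : Fin s.length, s.get i ∉ φ i.val := by
    intro i hi
    obtain ⟨n, hn⟩ := D.neBot.nonempty_of_mem ((hφ i _).1 hi)
    obtain ⟨rfl, -⟩ := hstem n
    exact (p n).stem_not_mem i hn
  refine ⟨⟨s, k, φ, hcard, hstem_not_mem⟩, rfl, rfl, hφ, fun r hr A hA => ?_⟩
  obtain ⟨hs, -, hsub⟩ := hr
  have havoid : (⋂ i : Fin r.s.length, { n | r.s.get i ∉ (p n).φ i }) ∈ (D : Filter ℕ) := by
    refine Filter.iInter_mem.2 fun i => Ultrafilter.compl_mem_iff_notMem.2 fun h => ?_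
    exact r.stem_not_mem i (hsub i ((hφ i _).2 h))
  obtain ⟨n, hnA, hn⟩ := D.neBot.nonempty_of_mem (Filter.inter_mem hA havoid)
  exact ⟨n, hnA, r.exists_le_le (p n) ((hstem n).1.symm ▸ hs) (Set.mem_iInter.1 hn)⟩
end

section
/- Fix a bijection e : ℕ → ℚ and let C = { x ∈ ℕ^ℕ : for all n, e(x(n)) > 0, and for every finite F ⊆ ℕ, Σ_{n∈F} e(x(n)) ≤ 1 }. Then C, with the subspace topology inherited from Baire space ℕ^ℕ, is homeomorphic to ℕ^ℕ. -/
/-- A map into Baire space is continuous if each output coordinate depends only on finitely many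
coordinates of a continuous map into Baire space. -/
theorem continuous_of_eq_of_prefix_eq {X : Type*} [TopologicalSpace X] {g : X → ℕ → ℕ}
    (hg : Continuous g) {f : X → ℕ → ℕ}
    (hf : ∀ n x y, (∀ i ∈ Finset.range (n + 1), g x i = g y i) → f x n = f y n) : Continuous f := by
  refine continuous_pi fun n => IsLocallyConstant.continuous ?_
  rw [IsLocallyConstant.iff_eventually_eq]
  intro x
  have h : ∀ᶠ y in nhds x, ∀ i ∈ Finset.range (n + 1), g y i = g x i := by
    rw [Filter.eventually_all_finset]
    intro i _
    have hi : Continuous fun y => g y i := (continuous_apply i).comp hg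
    exact hi.continuousAt.eventually_mem (IsOpen.mem_nhds (isOpen_discrete {g x i}) rfl)
  filter_upwards [h] with y hy using hf n y x hy

/-- The part of the unit interval that remains after removing `p 0, …, p (n - 1)`. -/
def remainder (p : ℕ → ℚ) (n : ℕ) : ℚ := 1 - ∑ i ∈ Finset.range n, p i

theorem remainder_succ (p : ℕ → ℚ) (n : ℕ) : remainder p (n + 1) = remainder p n - p n := by
  simp only [remainder, Finset.sum_range_succ]
  ring

theorem remainder_pos {p : ℕ → ℚ} (hp : ∀ n, 0 < p n) (hs : ∀ F : Finset ℕ, ∑ n ∈ F, p n ≤ 1)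
    (n : ℕ) : 0 < remainder p n := by
  have h := hs (Finset.range (n + 1))
  rw [Finset.sum_range_succ] at h
  have := hp n
  unfold remainder
  linarith

/-- The sequence whose successive ratios `p n / remainder p (n + 1)` are the given `t n`. -/
def ofRatios (t : ℕ → ℚ) (n : ℕ) : ℚ :=
  (∏ i ∈ Finset.range n, (1 + t i)⁻¹) - ∏ i ∈ Finset.range (n + 1), (1 + t i)⁻¹

theorem remainder_ofRatios (t : ℕ → ℚ) (n : ℕ) :
    remainder (ofRatios t) n = ∏ i ∈ Finset.range n, (1 + t i)⁻¹ := by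
  simp only [remainder, ofRatios, Finset.sum_range_sub', Finset.range_zero, Finset.prod_empty,
    sub_sub_cancel]

theorem prod_inv_one_add_pos {t : ℕ → ℚ} (ht : ∀ n, 0 < t n) (n : ℕ) :
    0 < ∏ i ∈ Finset.range n, (1 + t i)⁻¹ :=
  Finset.prod_pos fun i _ => by have := ht i; positivity

theorem ofRatios_eq {t : ℕ → ℚ} (ht : ∀ n, 0 < t n) (n : ℕ) :
    ofRatios t n = t n * ∏ i ∈ Finset.range (n + 1), (1 + t i)⁻¹ := by
  have := ht n
  rw [ofRatios, Finset.prod_range_succ]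
  field_simp
  ring

theorem ofRatios_pos {t : ℕ → ℚ} (ht : ∀ n, 0 < t n) (n : ℕ) : 0 < ofRatios t n := by
  rw [ofRatios_eq ht]
  exact mul_pos (ht n) (prod_inv_one_add_pos ht _)

theorem sum_ofRatios_le_one {t : ℕ → ℚ} (ht : ∀ n, 0 < t n) (F : Finset ℕ) :
    ∑ n ∈ F, ofRatios t n ≤ 1 := by
  obtain ⟨N, hN⟩ := F.exists_nat_subset_range
  have h : 0 < remainder (ofRatios t) N := by
    rw [remainder_ofRatios]
    exact prod_inv_one_add_pos ht N
  have hle := Finset.sum_le_sum_of_subset_of_nonneg hN fun i _ _ => (ofRatios_pos ht i).le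
  unfold remainder at h
  linarith

theorem ofRatios_div_remainder {t : ℕ → ℚ} (ht : ∀ n, 0 < t n) (n : ℕ) :
    ofRatios t n / remainder (ofRatios t) (n + 1) = t n := by
  rw [remainder_ofRatios, ofRatios_eq ht, mul_div_cancel_right₀ _ (prod_inv_one_add_pos ht _).ne']

theorem ofRatios_of_div_remainder {p : ℕ → ℚ} (hp : ∀ n, 0 < remainder p n) (n : ℕ) :
    ofRatios (fun i => p i / remainder p (i + 1)) n = p n := by
  have key (m : ℕ) :
      ∏ i ∈ Finset.range m, (1 + p i / remainder p (i + 1))⁻¹ = remainder p m := by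
    induction m with
    | zero => simp [remainder]
    | succ m ih =>
      have h₁ := hp (m + 1)
      have h₂ := hp m
      have h₃ : 1 + p m / remainder p (m + 1) = remainder p m / remainder p (m + 1) := by
        rw [eq_div_iff h₁.ne', add_mul, div_mul_cancel₀ _ h₁.ne', remainder_succ]
        ring
      rw [Finset.prod_range_succ, ih, h₃]
      field_simp
  rw [ofRatios, key, key, remainder_succ, sub_sub_cancel]

/-- The set `C ⊆ ℕ^ℕ`, encoding via the bijection `e : ℕ ≃ ℚ` the space of sequences of
strictly positive rationals with all finite partial sums at most `1`, with the subspace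
topology inherited from Baire space, is homeomorphic to Baire space `ℕ^ℕ`. -/
theorem stmt17 (e : ℕ ≃ ℚ) :
    Nonempty
      ((({ x : ℕ → ℕ | (∀ n, 0 < e (x n)) ∧
          ∀ F : Finset ℕ, ∑ n ∈ F, e (x n) ≤ 1 } : Set (ℕ → ℕ))) ≃ₜ (ℕ → ℕ)) := by
  have : Infinite {q : ℚ // 0 < q} := (Set.Ioi_infinite (0 : ℚ)).to_subtype
  obtain ⟨h⟩ := nonempty_equiv_of_countable (α := ℕ) (β := {q : ℚ // 0 < q})
  have ht (y : ℕ → ℕ) (n : ℕ) : 0 < (h (y n) : ℚ) := (h (y n)).2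
  refine ⟨{
    toFun := fun x n => h.symm ⟨e (x.1 n) / remainder (fun i => e (x.1 i)) (n + 1),
      div_pos (x.2.1 n) (remainder_pos x.2.1 x.2.2 _)⟩
    invFun := fun y => ⟨fun n => e.symm (ofRatios (fun i => h (y i)) n), by
      simp only [Set.mem_ofPred_eq, Equiv.apply_symm_apply]
      exact ⟨ofRatios_pos (ht y), sum_ofRatios_le_one (ht y)⟩⟩
    left_inv := fun x => by
      ext n
      simp only [Equiv.apply_symm_apply]
      rw [ofRatios_of_div_remainder (p := fun i => e (x.1 i)) (remainder_pos x.2.1 x.2.2),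
        Equiv.symm_apply_apply]
    right_inv := fun y => by
      ext n
      rw [Equiv.symm_apply_eq, Subtype.ext_iff]
      simp only [Equiv.apply_symm_apply]
      exact ofRatios_div_remainder (ht y) n
    continuous_toFun := continuous_of_eq_of_prefix_eq continuous_subtype_val fun n x y hxy => by
      have hsum : ∑ i ∈ Finset.range (n + 1), e (x.1 i) =
          ∑ i ∈ Finset.range (n + 1), e (y.1 i) :=
        Finset.sum_congr rfl fun i hi => by rw [hxy i hi]
      simp only [remainder, hsum, hxy n (Finset.self_mem_range_succ n)]
    continuous_invFun := continuous_induced_rng.2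
      (continuous_of_eq_of_prefix_eq continuous_id fun n x y hxy => by
        have hprod (m : ℕ) (hm : m ≤ n + 1) : ∏ i ∈ Finset.range m, (1 + (h (x i) : ℚ))⁻¹ =
            ∏ i ∈ Finset.range m, (1 + (h (y i) : ℚ))⁻¹ :=
          Finset.prod_congr rfl fun i hi => by
            rw [show x i = y i from hxy i (Finset.range_mono hm hi)]
        simp only [Function.comp_apply, ofRatios, hprod n n.le_succ, hprod (n + 1) le_rfl]) }⟩
end

section
/- Let F ⊆ 2^ℕ be R₂-unbounded, i.e., there is no g ∈ 2^ℕ with f R₂ g for all f ∈ F. Then the family of measure-zero sets N_f = { g ∈ 2^ℕ : f↾I_n = g↾I_n for infinitely many n }, for f ∈ F, covers 2^ℕ. Moreover, every subset X ⊆ 2^ℕ that is not of measure zero is R₂-dominating, i.e., for every f ∈ 2^ℕ there is x ∈ X with f R₂ x. -/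
open MeasureTheory Filter

/-- `N_f = { g | f ↾ I n = g ↾ I n for infinitely many n }`. -/
def Nset (f : ℕ → Bool) : Set (ℕ → Bool) :=
  { g | ∃ᶠ n in atTop, ∀ m ∈ Ipart n, f m = g m }

/-- The set `{g | f ↾ I n = g ↾ I n for infinitely many n}` is null, by Borel–Cantelli. -/
theorem measure_Nset_eq_zero {μ : Measure (ℕ → Bool)}
    (hμ : ∀ s : Finset ℕ, ∀ y : ℕ → Bool,
      μ { f | ∀ i ∈ s, f i = y i } = (2 : ENNReal)⁻¹ ^ s.card) (f : ℕ → Bool) :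
    μ (Nset f) = 0 := by
  refine measure_setOfPred_frequently_eq_zero
    (p := fun n (g : ℕ → Bool) => ∀ m ∈ Ipart n, f m = g m) ?_
  have hle (n : ℕ) : μ { g | ∀ m ∈ Ipart n, f m = g m } ≤ (2 : ENNReal)⁻¹ ^ n := by
    simp only [eq_comm (a := f _), hμ]
    refine pow_le_pow_right_of_le_one' (ENNReal.inv_le_one.2 one_le_two) ?_
    have hn : n < 2 ^ n := Nat.lt_two_pow_self
    simp only [Ipart, Nat.card_Ico, pow_succ]
    omega
  refine ((ENNReal.tsum_le_tsum hle).trans_lt ?_).ne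
  rw [ENNReal.tsum_geometric, ENNReal.one_sub_inv_two, inv_inv]
  exact ENNReal.ofNat_lt_top

/-- The set `Nset f` is the complement of `{g | R2 f g}`. -/
theorem mem_Nset_iff_not_R2 {f g : ℕ → Bool} : g ∈ Nset f ↔ ¬ R2 f g := by
  simp only [Nset, R2, Set.mem_ofPred_eq, not_eventually, not_exists, not_and, not_not]

/-- Statement 18, for the product of the uniform probability measures on `{0,1}`,
characterized by its values on cylinders: if `F` is `R₂`-unbounded then the family of
measure-zero sets `N_f` (`f ∈ F`) covers Cantor space; moreover every set that is not of
measure zero is `R₂`-dominating. -/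
theorem stmt18 (μ : Measure (ℕ → Bool))
    (hμ : ∀ s : Finset ℕ, ∀ y : ℕ → Bool,
      μ { f | ∀ i ∈ s, f i = y i } = (2 : ENNReal)⁻¹ ^ s.card)
    (F : Set (ℕ → Bool)) (hF : ¬ ∃ g : ℕ → Bool, ∀ f ∈ F, R2 f g) :
    (∀ f : ℕ → Bool, μ (Nset f) = 0) ∧
    (⋃ f ∈ F, Nset f) = Set.univ ∧
    ∀ X : Set (ℕ → Bool), μ X ≠ 0 → ∀ f : ℕ → Bool, ∃ x ∈ X, R2 f x := by
  refine ⟨measure_Nset_eq_zero hμ, Set.eq_univ_of_forall fun g => ?_, fun X hX f => ?_⟩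
  · push Not at hF
    obtain ⟨f, hf, hfg⟩ := hF g
    exact Set.mem_biUnion hf (mem_Nset_iff_not_R2.2 hfg)
  · by_contra! h
    exact hX (measure_mono_null (fun x hx => mem_Nset_iff_not_R2.2 (h x hx))
      (measure_Nset_eq_zero hμ f))
end
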